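/- 2×2×3 Abalone is a draw under optimal play: the initial constellation C0 has outcome class D, i.e., with both players playing optimally neither can force a win and the game continues indefinitely, with play confined (up to isomorphism) to 13 constellations C0, C1, C2, C3, ±C4, ±C5, C6, ±C7, ±C8. -/

import Mathlib

/-- An abstract two-player game with perfect information and alternating moves.
`true` denotes Left (Black) and `false` denotes Right (Gray). -/
structure AGame (P : Type*) where
  /-- `move pl p q` : player `pl` has a legal move from position `p` to position `q`. -/
  move : Bool → P → P → Prop
  /-- `win pl p` : the position `p` is a terminal win for player `pl`. -/
  win : Bool → P → Prop

namespace AGame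

variable {P : Type*}

/-- `FW G pl turn p` : player `pl` can force a win (in finitely many moves)
from position `p` when it is `turn`'s move. -/
inductive FW (G : AGame P) (pl : Bool) : Bool → P → Prop
  | terminal (turn : Bool) (p : P) : G.win pl p → FW G pl turn p
  | self (p q : P) : ¬ G.win (!pl) p → G.move pl p q → FW G pl (!pl) q → FW G pl pl p
  | opp (p : P) : ¬ G.win (!pl) p → (∃ q, G.move (!pl) p q) →
      (∀ q, G.move (!pl) p q → FW G pl pl q) → FW G pl (!pl) p

/-- Outcome class `L` : Left (Black) always wins, whoever moves first. -/
def OutL (G : AGame P) (p : P) : Prop := G.FW true true p ∧ G.FW true false p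

/-- Outcome class `R` : Right (Gray) always wins, whoever moves first. -/
def OutR (G : AGame P) (p : P) : Prop := G.FW false false p ∧ G.FW false true p

/-- Outcome class `N` : whoever moves next wins. -/
def OutN (G : AGame P) (p : P) : Prop := G.FW true true p ∧ G.FW false false p

/-- Outcome class `D` : neither player can force a win (optimal play is an infinite draw). -/
def OutD (G : AGame P) (p : P) : Prop :=
  ¬ G.FW true true p ∧ ¬ G.FW true false p ∧ ¬ G.FW false true p ∧ ¬ G.FW false false p

/-- Outcome class `N̂` : Left wins moving first, and the game is a draw if Right moves first. -/
def OutNhat (G : AGame P) (p : P) : Prop :=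
  G.FW true true p ∧ ¬ G.FW true false p ∧ ¬ G.FW false false p

/-- Outcome class `Ň` : Right wins moving first, and the game is a draw if Left moves first. -/
def OutNcheck (G : AGame P) (p : P) : Prop :=
  G.FW false false p ∧ ¬ G.FW false true p ∧ ¬ G.FW true true p

end AGame

namespace Abalone

/-- A board cell, in axial hexagonal coordinates `(q, r)` where `q` is the column. -/
abbrev Cell : Type := ℤ × ℤ

/-- A constellation: each cell carries a black marble (`some true`),
a gray marble (`some false`), or is empty (`none`). -/
abbrev Pos : Type := Cell → Option Bool

/-- The six unit directions of the hexagonal grid. -/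
def dirs : List Cell := [(1, 0), (0, 1), (-1, 1), (-1, 0), (0, -1), (1, -1)]

/-- Add a direction to a cell. -/
def addc (x d : Cell) : Cell := (x.1 + d.1, x.2 + d.2)

/-- The cell `n` steps from `x` in direction `d`. -/
def stepc (x : Cell) (n : ℕ) (d : Cell) : Cell := (x.1 + (n : ℤ) * d.1, x.2 + (n : ℤ) * d.2)

/-- The opposite direction. -/
def negd (d : Cell) : Cell := (-d.1, -d.2)

open Classical in
/-- The result of shifting the line of `len` marbles starting one step after `x`
(in direction `d`, with the marble at `x` itself moving into the vacated space):
cell `x` is vacated, each cell `x + i·d` (`1 ≤ i ≤ len`) receives the content of its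
predecessor, and marbles shifted off the board are removed. -/
noncomputable def shiftResult (board : Finset Cell) (c : Pos) (x d : Cell) (len : ℕ) : Pos :=
  fun y =>
    if y ∉ board then none
    else if y = x then none
    else if ∃ i : ℕ, 1 ≤ i ∧ i ≤ len ∧ y = stepc x i d then c (addc y (negd d))
    else c y

/-- In-line movement (including sumito pushes): player `pl` moves a line of `k` of their
own contiguous marbles (`1 ≤ k ≤ maxG`) one step in the line's direction `d`, possibly
pushing a strictly shorter opposing line of `m < k` marbles, the leading opposing marble
being pushed either onto an empty board cell or off the board. -/
def InlineMove (board : Finset Cell) (maxG : ℕ) (pl : Bool) (c c' : Pos) : Prop :=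
  ∃ x d, d ∈ dirs ∧ ∃ k m : ℕ,
    1 ≤ k ∧ k ≤ maxG ∧ m < k ∧
    (∀ i < k, stepc x i d ∈ board ∧ c (stepc x i d) = some pl) ∧
    (∀ i, k ≤ i → i < k + m → stepc x i d ∈ board ∧ c (stepc x i d) = some (!pl)) ∧
    ((m = 0 ∧ stepc x k d ∈ board ∧ c (stepc x k d) = none) ∨
      (1 ≤ m ∧ (stepc x (k + m) d ∉ board ∨ c (stepc x (k + m) d) = none))) ∧
    c' = shiftResult board c x d (k + m)

open Classical in
/-- The result of a broadside move: the `k` marbles at `x + i·d` (`i < k`) each move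
one step in direction `e`. -/
noncomputable def broadResult (c : Pos) (pl : Bool) (x d e : Cell) (k : ℕ) : Pos :=
  fun y =>
    if ∃ i < k, y = stepc x i d then none
    else if ∃ i < k, y = addc (stepc x i d) e then some pl
    else c y

/-- Broadside movement: player `pl` moves a line of `k` of their own contiguous marbles
(`1 ≤ k ≤ maxG`, the line in direction `d`) one step in a direction `e` not along the
line, each marble landing on an empty board cell. -/
def BroadsideMove (board : Finset Cell) (maxG : ℕ) (pl : Bool) (c c' : Pos) : Prop :=
  ∃ x d e, d ∈ dirs ∧ e ∈ dirs ∧ e ≠ d ∧ e ≠ negd d ∧ ∃ k : ℕ,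
    1 ≤ k ∧ k ≤ maxG ∧
    (∀ i < k, stepc x i d ∈ board ∧ c (stepc x i d) = some pl) ∧
    (∀ i < k, addc (stepc x i d) e ∈ board ∧ c (addc (stepc x i d) e) = none) ∧
    c' = broadResult c pl x d e k

/-- A legal Abalone move for player `pl`. -/
def Move (board : Finset Cell) (maxG : ℕ) (pl : Bool) (c c' : Pos) : Prop :=
  InlineMove board maxG pl c c' ∨ BroadsideMove board maxG pl c c'

/-- The number of marbles of player `pl` on the board. -/
def countM (board : Finset Cell) (pl : Bool) (c : Pos) : ℕ :=
  (board.filter (fun y => c y = some pl)).card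

/-- Player `pl` has won: the opponent has fewer than `n` marbles left,
i.e. at least one opposing marble has been pushed off the board. -/
def Wins (board : Finset Cell) (n : ℕ) (pl : Bool) (c : Pos) : Prop :=
  countM board (!pl) c < n

/-- The negative of a constellation: swap black and gray marbles. -/
def negP (c : Pos) : Pos := fun y => (c y).map (fun b => !b)

end Abalone

namespace Abalone

/-! ### The 2×2×3 Abalone board

A hexagonal grid of 10 cells with columns of sizes 3, 4, 3, labelled as in the paper:
`a, b, c` the left column (bottom to top), `d, e, f, g` the middle column (bottom to
top, with `e, f` the two central spaces), and `h, i, j` the right column (bottom to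
top). Each player has 3 marbles, may move 1–3 contiguous marbles, a strictly longer
line pushes a shorter opposing line, and a player wins by ejecting one opposing
marble. -/

def ca : Cell := (-1, 2)
def cb : Cell := (-1, 1)
def cc : Cell := (-1, 0)
def cd : Cell := (0, 2)
def ce : Cell := (0, 1)
def cf : Cell := (0, 0)
def cg : Cell := (0, -1)
def ch : Cell := (1, 1)
def ci : Cell := (1, 0)
def cj : Cell := (1, -1)

def board223 : Finset Cell := {ca, cb, cc, cd, ce, cf, cg, ch, ci, cj}

/-- 2×2×3 Abalone as a game: moves of 1–3 contiguous marbles, win by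
reducing the opponent to fewer than 3 marbles. -/
def G223 : AGame Pos :=
  { move := Move board223 3
    win := Wins board223 3 }

/-- The constellation with black marbles on `b1, b2, b3` and gray marbles
on `g1, g2, g3`. -/
def mk3 (b1 b2 b3 g1 g2 g3 : Cell) : Pos := fun y =>
  if y = b1 ∨ y = b2 ∨ y = b3 then some true
  else if y = g1 ∨ y = g2 ∨ y = g3 then some false
  else none

/-- The boards `C0`–`C8` of the paper (Figure 8). -/
def C0 : Pos := mk3 cc cg cj ca cd ch
def C1 : Pos := mk3 cc cf cg ca cd ch
def C2 : Pos := mk3 cc cf cg ca cd ce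
def C3 : Pos := mk3 cc cf cg ce cd ch
def C4 : Pos := mk3 cb cf cg ca cd ce
def C5 : Pos := mk3 cc cb cg ca cd ce
def C6 : Pos := mk3 cb cf cg ce cd ci
def C7 : Pos := mk3 cb cc cg ci cd ce
def C8 : Pos := mk3 cc cf cg ci cd ce

/-- A valid 2×2×3 constellation: all marbles on the board,
3 black and 3 gray marbles. -/
def Valid223 (c : Pos) : Prop :=
  (∀ y, y ∉ board223 → c y = none) ∧
  countM board223 true c = 3 ∧ countM board223 false c = 3

/-- `c` contains (up to the symmetries of the board) the neutral subconfiguration: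
two Gray marbles in a corner column pair threaten an adjacent Black marble in the
same column (e.g. Gray on `a` and `b` threatening Black on `c`). -/
def ContainsNeutral (c : Pos) : Prop :=
  (c ca = some false ∧ c cb = some false ∧ c cc = some true) ∨
  (c cb = some false ∧ c cc = some false ∧ c ca = some true) ∨
  (c ch = some false ∧ c ci = some false ∧ c cj = some true) ∨
  (c ci = some false ∧ c cj = some false ∧ c ch = some true)

end Abalone

namespace AGame

/-- If `A` (with `pl` to move) and `D` (with the opponent to move) are safe for the opponent of
`pl`, in the sense that the opponent can keep the play inside them until possibly winning,
then `pl` cannot force a win from them. -/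
theorem FW.not_safe {P : Type*} {G : AGame P} {pl : Bool} {A D : P → Prop}
    (hA : ∀ p, A p → ¬ G.win pl p ∧ (G.win (!pl) p ∨ ∀ q, G.move pl p q → D q))
    (hD : ∀ q, D q → ¬ G.win pl q ∧ ∃ r, G.move (!pl) q r ∧ A r)
    {turn : Bool} {p : P} (h : G.FW pl turn p) :
    (turn = pl → ¬ A p) ∧ (turn = (!pl) → ¬ D p) := by
  induction h with
  | terminal turn p hw => exact ⟨fun _ hp => (hA p hp).1 hw, fun _ hp => (hD p hp).1 hw⟩
  | self p q hw hm _ ih =>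
    refine ⟨fun _ hp => ?_, fun h => by cases pl <;> simp at h⟩
    rcases (hA p hp).2 with h | h
    · exact hw h
    · exact ih.2 rfl (h q hm)
  | opp p hw _ _ ih =>
    refine ⟨fun h => by cases pl <;> simp at h, fun _ hp => ?_⟩
    obtain ⟨-, r, hr, hAr⟩ := hD p hp
    exact (ih r hr).1 rfl hAr

end AGame

namespace Abalone

/-! ### Numerical codes for constellations -/

def cells : List Cell := [ca, cb, cc, cd, ce, cf, cg, ch, ci, cj]

theorem board223_eq : board223 = cells.toFinset := rfl

theorem mem_cells {y : Cell} : y ∈ cells ↔ y ∈ board223 := by simp [board223_eq]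

/-- The position of a cell in `cells`, and `10` for a cell off the board. -/
def cellIndex : Cell → ℕ
  | (.negSucc 0, .ofNat 2) => 0
  | (.negSucc 0, .ofNat 1) => 1
  | (.negSucc 0, .ofNat 0) => 2
  | (.ofNat 0, .ofNat 2) => 3
  | (.ofNat 0, .ofNat 1) => 4
  | (.ofNat 0, .ofNat 0) => 5
  | (.ofNat 0, .negSucc 0) => 6
  | (.ofNat 1, .ofNat 1) => 7
  | (.ofNat 1, .ofNat 0) => 8
  | (.ofNat 1, .negSucc 0) => 9
  | _ => 10

theorem cellIndex_of_notMem {y : Cell} (hy : y ∉ board223) : cellIndex y = 10 := by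
  unfold cellIndex
  split
  case h_11 => rfl
  all_goals exact absurd (by decide) hy

theorem cellIndex_lt {y : Cell} (hy : y ∈ board223) : cellIndex y < 10 := by
  revert y; decide

theorem cellIndex_eq_iff {y : Cell} (hy : y ∈ board223) (z : Cell) :
    cellIndex y = cellIndex z ↔ y = z := by
  refine ⟨fun h => ?_, fun h => h ▸ rfl⟩
  by_cases hz : z ∈ board223
  · have key : ∀ y ∈ board223, ∀ z ∈ board223, cellIndex y = cellIndex z → y = z := by decide
    exact key y hy z hz h
  · have := cellIndex_lt hy
    rw [cellIndex_of_notMem hz] at h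
    omega

/-- The base-3 digit of the content of a cell. -/
def digit : Option Bool → ℕ
  | none => 0
  | some true => 1
  | some false => 2

def ofDigit : ℕ → Option Bool
  | 0 => none
  | 1 => some true
  | _ => some false

theorem ofDigit_digit (o : Option Bool) : ofDigit (digit o) = o := by
  rcases o with _ | _ | _ <;> rfl

theorem digit_lt (o : Option Bool) : digit o < 3 := by
  rcases o with _ | _ | _ <;> decide

/-- The contents of the board as a base-3 numeral. -/
def encode (f : Pos) : ℕ := cells.foldr (fun y n => 3 * n + digit (f y)) 0

def decode (n : ℕ) : Pos := fun y => ofDigit (n % 3 ^ 10 / 3 ^ cellIndex y % 3)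

theorem decode_of_notMem (n : ℕ) {y : Cell} (hy : y ∉ board223) : decode n y = none := by
  have : n % 3 ^ 10 / 3 ^ 10 = 0 := Nat.div_eq_of_lt (Nat.mod_lt _ (by norm_num))
  simp only [decode, cellIndex_of_notMem hy, this]
  rfl

theorem mem_of_decode_eq_some {n : ℕ} {y : Cell} {b : Bool} (h : decode n y = some b) :
    y ∈ board223 := by
  by_contra hy
  simp [decode_of_notMem n hy] at h

theorem decode_encode_of_mem (f : Pos) {y : Cell} (hy : y ∈ board223) :
    decode (encode f) y = f y := by
  have key : encode f % 3 ^ 10 / 3 ^ cellIndex y % 3 = digit (f y) := by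
    have := fun c => digit_lt (f c)
    have h0 := this ca
    have h1 := this cb
    have h2 := this cc
    have h3 := this cd
    have h4 := this ce
    have h5 := this cf
    have h6 := this cg
    have h7 := this ch
    have h8 := this ci
    have h9 := this cj
    simp only [board223, Finset.mem_insert, Finset.mem_singleton] at hy
    simp only [encode, cells, List.foldr]
    rcases hy with rfl | rfl | rfl | rfl | rfl | rfl | rfl | rfl | rfl | rfl <;>
      simp only [show cellIndex ca = 0 from rfl, show cellIndex cb = 1 from rfl,
        show cellIndex cc = 2 from rfl, show cellIndex cd = 3 from rfl,
        show cellIndex ce = 4 from rfl, show cellIndex cf = 5 from rfl,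
        show cellIndex cg = 6 from rfl, show cellIndex ch = 7 from rfl,
        show cellIndex ci = 8 from rfl, show cellIndex cj = 9 from rfl] <;>
      omega
  rw [decode, key, ofDigit_digit]

theorem decode_encode {f : Pos} (hf : ∀ y ∉ board223, f y = none) : decode (encode f) = f := by
  funext y
  by_cases hy : y ∈ board223
  · exact decode_encode_of_mem f hy
  · rw [decode_of_notMem _ hy, hf y hy]

theorem encode_congr {f g : Pos} (h : ∀ y ∈ board223, f y = g y) : encode f = encode g := by
  simp [board223] at h
  simp [encode, cells, h]

/-- The number of marbles of player `pl` in the constellation coded by `n`. -/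
def count (n : ℕ) (pl : Bool) : ℕ := (cells.filter fun y => decode n y = some pl).length

theorem countM_decode (n : ℕ) (pl : Bool) : countM board223 pl (decode n) = count n pl := by
  have hnd : cells.Nodup := by decide
  rw [countM, count, board223_eq, ← List.toFinset_card_of_nodup (hnd.filter _),
    List.toFinset_filter]
  simp

/-! ### Computing moves on codes -/

def shiftCode (n : ℕ) (x d : Cell) (len : ℕ) : ℕ :=
  encode fun y =>
    if cellIndex y = cellIndex x then none
    else if ∃ i < len, cellIndex y = cellIndex (stepc x (i + 1) d) then
      decode n (addc y (negd d))
    else decode n y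

def broadCode (n : ℕ) (pl : Bool) (x d e : Cell) (k : ℕ) : ℕ :=
  encode fun y =>
    if ∃ i < k, cellIndex y = cellIndex (stepc x i d) then none
    else if ∃ i < k, cellIndex y = cellIndex (addc (stepc x i d) e) then some pl
    else decode n y

theorem encode_shiftResult (n : ℕ) (x d : Cell) (len : ℕ) :
    encode (shiftResult board223 (decode n) x d len) = shiftCode n x d len := by
  refine encode_congr fun y hy => ?_
  have h : (∃ i : ℕ, 1 ≤ i ∧ i ≤ len ∧ y = stepc x i d) ↔
      ∃ i < len, y = stepc x (i + 1) d := by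
    constructor
    · rintro ⟨i, h1, h2, h3⟩
      exact ⟨i - 1, by omega, by rwa [Nat.sub_add_cancel h1]⟩
    · rintro ⟨i, h1, h2⟩
      exact ⟨i + 1, by omega, by omega, h2⟩
  simp only [shiftResult, cellIndex_eq_iff hy, h, hy, not_true_eq_false, if_false]

theorem encode_broadResult (n : ℕ) (pl : Bool) (x d e : Cell) (k : ℕ) :
    encode (broadResult (decode n) pl x d e k) = broadCode n pl x d e k := by
  refine encode_congr fun y hy => ?_
  simp only [broadResult, cellIndex_eq_iff hy]

def InlineLegal (n : ℕ) (pl : Bool) (x d : Cell) (k m : ℕ) : Prop :=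
  (∀ i < k, decode n (stepc x i d) = some pl) ∧
  (∀ i < m, decode n (stepc x (k + i) d) = some (!pl)) ∧
  decode n (stepc x (k + m) d) = none ∧ (m = 0 → cellIndex (stepc x k d) < 10)

def BroadLegal (n : ℕ) (pl : Bool) (x d e : Cell) (k : ℕ) : Prop :=
  (∀ i < k, decode n (stepc x i d) = some pl) ∧
  ∀ i < k, decode n (addc (stepc x i d) e) = none ∧ cellIndex (addc (stepc x i d) e) < 10

instance (n : ℕ) (pl : Bool) (x d : Cell) (k m : ℕ) : Decidable (InlineLegal n pl x d k m) := by
  unfold InlineLegal; infer_instance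

instance (n : ℕ) (pl : Bool) (x d e : Cell) (k : ℕ) : Decidable (BroadLegal n pl x d e k) := by
  unfold BroadLegal; infer_instance

theorem stepc_zero (x d : Cell) : stepc x 0 d = x := by simp [stepc]

theorem stepc_one (x d : Cell) : stepc x 1 d = addc x d := by simp [stepc, addc]

theorem addc_addc_negd (x d : Cell) : addc (addc x d) (negd d) = x := by simp [addc, negd]

theorem BroadLegal.inlineLegal_one {n : ℕ} {pl : Bool} {x d e : Cell}
    (h : BroadLegal n pl x d e 1) : InlineLegal n pl x e 1 0 := by
  have h1 := h.1 0 one_pos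
  have h2 := h.2 0 one_pos
  rw [stepc_zero] at h1 h2
  refine ⟨fun i hi => ?_, by simp, ?_⟩
  · rw [Nat.lt_one_iff.1 hi, stepc_zero, h1]
  · simpa [stepc_one] using h2

theorem BroadLegal.broadCode_one {n : ℕ} {pl : Bool} {x d e : Cell}
    (h : BroadLegal n pl x d e 1) : broadCode n pl x d e 1 = shiftCode n x e 1 := by
  have h1 := h.1 0 one_pos
  rw [stepc_zero] at h1
  refine encode_congr fun y hy => ?_
  simp only [Nat.lt_one_iff, exists_eq_left, stepc_zero, zero_add, stepc_one,
    cellIndex_eq_iff hy]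
  split_ifs with hx he
  · rfl
  · rw [he, addc_addc_negd, h1]
  · rfl

/-- Whether player `pl` has a move in the constellation coded by `n` to one whose code
satisfies `Q`. -/
def anyMove (n : ℕ) (pl : Bool) (Q : ℕ → Bool) : Bool :=
  cells.any fun x => decide (decode n x = some pl) && dirs.any fun d =>
    ([(1, 0), (2, 0), (2, 1), (3, 0), (3, 1), (3, 2)].any fun km =>
      decide (InlineLegal n pl x d km.1 km.2) && Q (shiftCode n x d (km.1 + km.2))) ||
    decide (decode n (stepc x 1 d) = some pl) && dirs.any fun e =>
      (decide (e ≠ d) && decide (e ≠ negd d)) && [2, 3].any fun k =>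
        decide (BroadLegal n pl x d e k) && Q (broadCode n pl x d e k)

theorem mem_board223_iff {y : Cell} : y ∈ board223 ↔ cellIndex y < 10 := by
  refine ⟨cellIndex_lt, fun h => ?_⟩
  by_contra hy
  rw [cellIndex_of_notMem hy] at h
  omega

theorem inlineMove_iff {n : ℕ} {pl : Bool} {q : Pos} :
    InlineMove board223 3 pl (decode n) q ↔
      ∃ x d, d ∈ dirs ∧ ∃ k m : ℕ, 1 ≤ k ∧ k ≤ 3 ∧ m < k ∧ InlineLegal n pl x d k m ∧
        q = shiftResult board223 (decode n) x d (k + m) := by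
  unfold InlineMove InlineLegal
  refine exists_congr fun x => exists_congr fun d => and_congr_right fun _ =>
    exists_congr fun k => exists_congr fun m => and_congr_right fun _ => and_congr_right fun _ =>
    and_congr_right fun _ => ?_
  constructor
  · rintro ⟨h1, h2, h3, rfl⟩
    refine ⟨⟨fun i hi => (h1 i hi).2, fun i hi => (h2 (k + i) (by omega) (by omega)).2, ?_⟩, rfl⟩
    rcases h3 with ⟨rfl, hb, hc⟩ | ⟨hm, h⟩
    · exact ⟨hc, fun _ => cellIndex_lt hb⟩
    · exact ⟨h.elim (decode_of_notMem n) id, fun h0 => by omega⟩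
  · rintro ⟨⟨h1, h2, h3, h4⟩, rfl⟩
    refine ⟨fun i hi => ⟨mem_of_decode_eq_some (h1 i hi), h1 i hi⟩, fun i hi hi' => ?_, ?_, rfl⟩
    · have := h2 (i - k) (by omega)
      rw [Nat.add_sub_cancel' hi] at this
      exact ⟨mem_of_decode_eq_some this, this⟩
    · rcases Nat.eq_zero_or_pos m with rfl | hm
      · exact Or.inl ⟨rfl, mem_board223_iff.2 (h4 rfl), h3⟩
      · exact Or.inr ⟨hm, Or.inr h3⟩

theorem broadsideMove_iff {n : ℕ} {pl : Bool} {q : Pos} :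
    BroadsideMove board223 3 pl (decode n) q ↔
      ∃ x d e, d ∈ dirs ∧ e ∈ dirs ∧ e ≠ d ∧ e ≠ negd d ∧ ∃ k : ℕ, 1 ≤ k ∧ k ≤ 3 ∧
        BroadLegal n pl x d e k ∧ q = broadResult (decode n) pl x d e k := by
  unfold BroadsideMove BroadLegal
  refine exists_congr fun x => exists_congr fun d => exists_congr fun e =>
    and_congr_right fun _ => and_congr_right fun _ => and_congr_right fun _ =>
    and_congr_right fun _ => exists_congr fun k => and_congr_right fun _ =>
    and_congr_right fun _ => ?_
  rw [and_assoc]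
  refine and_congr (forall₂_congr fun i _ => ?_) (and_congr_left fun _ =>
    forall₂_congr fun i _ => ?_)
  · exact ⟨And.right, fun h => ⟨mem_of_decode_eq_some h, h⟩⟩
  · rw [mem_board223_iff, and_comm]

theorem Move.decode_encode {n : ℕ} {pl : Bool} {q : Pos}
    (h : Move board223 3 pl (decode n) q) : decode (encode q) = q := by
  refine Abalone.decode_encode fun y hy => ?_
  rcases h with ⟨x, d, -, k, m, -, -, -, -, -, -, rfl⟩ | ⟨x, d, e, -, -, -, -, k, -, -, -, h, rfl⟩
  · simp [shiftResult, hy]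
  · have : ¬ ∃ i < k, y = addc (stepc x i d) e := by
      rintro ⟨i, hi, rfl⟩
      exact hy (h i hi).1
    simp [broadResult, this, decode_of_notMem n hy]

theorem anyMove_iff {n : ℕ} {pl : Bool} {Q : ℕ → Bool} :
    anyMove n pl Q = true ↔ ∃ q, Move board223 3 pl (decode n) q ∧ Q (encode q) = true := by
  simp only [anyMove, List.any_eq_true, Bool.and_eq_true, Bool.or_eq_true, decide_eq_true_eq,
    Move, inlineMove_iff, broadsideMove_iff]
  constructor
  · rintro ⟨x, -, -, d, hd, ⟨⟨k, m⟩, hkm, hl, hQ⟩ |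
      ⟨-, e, he, ⟨hed, hed'⟩, k, hk, hl, hQ⟩⟩
    · have : 1 ≤ k ∧ k ≤ 3 ∧ m < k := by
        simp at hkm
        omega
      exact ⟨_, Or.inl ⟨x, d, hd, k, m, this.1, this.2.1, this.2.2, hl, rfl⟩,
        by rwa [encode_shiftResult]⟩
    · have : 1 ≤ k ∧ k ≤ 3 := by
        simp at hk
        omega
      exact ⟨_, Or.inr ⟨x, d, e, hd, he, hed, hed', k, this.1, this.2, hl, rfl⟩,
        by rwa [encode_broadResult]⟩
  · rintro ⟨_, ⟨x, d, hd, k, m, h1, h3, hmk, hl, rfl⟩ |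
      ⟨x, d, e, hd, he, hed, hed', k, h1, h3, hl, rfl⟩, hQ⟩
    · have hx := hl.1 0 h1
      rw [stepc_zero] at hx
      rw [encode_shiftResult] at hQ
      refine ⟨x, mem_cells.2 (mem_of_decode_eq_some hx), hx, d, hd, Or.inl ⟨(k, m), ?_, hl, hQ⟩⟩
      simp
      omega
    · have hx := hl.1 0 h1
      rw [stepc_zero] at hx
      rw [encode_broadResult] at hQ
      refine ⟨x, mem_cells.2 (mem_of_decode_eq_some hx), hx, ?_⟩
      rcases h1.eq_or_lt with rfl | h2
      · exact ⟨e, he, Or.inl ⟨(1, 0), by simp, hl.inlineLegal_one, hl.broadCode_one ▸ hQ⟩⟩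
      · refine ⟨d, hd, Or.inr ⟨hl.1 1 h2, e, he, ⟨hed, hed'⟩, k, ?_, hl, hQ⟩⟩
        simp
        omega

/-! ### The drawing strategies -/

/-- With `pl` to move, the opponent of `pl` has just won or the code is in the list `S`. -/
def attackSafe (pl : Bool) (S : List ℕ) (n : ℕ) : Bool :=
  (S.any (Nat.beq n) || decide (count n pl < 3)) && decide (3 ≤ count n (!pl))

/-- The opponent of `pl` has a move to an `attackSafe` constellation. -/
def defendSafe (pl : Bool) (S : List ℕ) (n : ℕ) : Bool :=
  decide (3 ≤ count n (!pl)) && anyMove n (!pl) (attackSafe pl S)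

theorem not_FW_of_closed {pl : Bool} {S : List ℕ}
    (hS : (S.all fun n => !anyMove n pl fun c => !defendSafe pl S c) = true) (n : ℕ) :
    (attackSafe pl S n = true → ¬ G223.FW pl pl (decode n)) ∧
      (defendSafe pl S n = true → ¬ G223.FW pl (!pl) (decode n)) := by
  have hwin : ∀ (b : Bool) (c : ℕ), G223.win b (decode c) ↔ count c (!b) < 3 := fun b c => by
    rw [← countM_decode]; rfl
  have key := fun {turn : Bool} (h : G223.FW pl turn (decode n)) => h.not_safe
    (A := fun p => ∃ c, p = decode c ∧ attackSafe pl S c = true)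
    (D := fun p => ∃ c, p = decode c ∧ defendSafe pl S c = true) ?_ ?_
  · exact ⟨fun hn h => (key h).1 rfl ⟨n, rfl, hn⟩, fun hn h => (key h).2 rfl ⟨n, rfl, hn⟩⟩
  · rintro _ ⟨c, rfl, hc⟩
    simp only [attackSafe, Bool.and_eq_true, Bool.or_eq_true, decide_eq_true_eq,
      List.any_eq_true, Nat.beq_eq] at hc
    rw [hwin, hwin, Bool.not_not]
    refine ⟨by omega, hc.1.symm.imp id ?_⟩
    rintro ⟨_, hcS, rfl⟩ q hq
    refine ⟨encode q, (Move.decode_encode hq).symm, ?_⟩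
    by_contra hq'
    have := List.all_eq_true.1 hS c hcS
    rw [Bool.not_eq_true', ← Bool.not_eq_true, anyMove_iff] at this
    exact this ⟨q, hq, by simpa using hq'⟩
  · rintro _ ⟨c, rfl, hc⟩
    simp only [defendSafe, Bool.and_eq_true, decide_eq_true_eq, anyMove_iff] at hc
    obtain ⟨h3, r, hr, hAr⟩ := hc
    rw [hwin]
    exact ⟨by omega, r, hr, encode r, (Move.decode_encode hr).symm, hAr⟩

/-- Constellations among which Black can remain forever, whatever Gray plays. -/
def blackSafe : List Pos := [
  C0, mk3 cc cf cg ca cd ce, mk3 cf cg ci ca cb ch, mk3 ce cf ci ca cb cd,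
  mk3 ce cf cj ca cd ci, mk3 cf cg cj ca cd ch, mk3 cf cg ci cd ce ch, mk3 cf cg cj cb cd ce,
  mk3 cf cg ci cb cd ce, mk3 cb cf cg cd ce cj, mk3 ce cf ci ca cd ch, mk3 cb ce cf ca ch ci,
  mk3 cb cf cg ca ce cj, mk3 cc cf cj ca cd ci, mk3 cf ci cj cb cd ch, mk3 cc cf cj ca ce ch,
  mk3 cb ce cf ca cd ci, mk3 cc cf cj cb cd ch, mk3 cc cf cg ca ce ci, mk3 cc cf cg cd ce ch,
  mk3 cc cf cg cb ce ch, mk3 cf ci cj ca cb ch, mk3 cf cg ci ca cb cd, mk3 cf cg ci cc cd ce,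
  mk3 cb cf cg ca cd ce, mk3 cb ce cf ca cd ch, mk3 cc cf cg cd ce ci]

/-- Exchange the colours and reflect the board, preserving `C0`. -/
def mirror (f : Pos) : Pos := fun y => negP f (y.1, 1 - y.1 - y.2)

theorem blackSafe_closed :
    ((blackSafe.map encode).all fun n =>
      !anyMove n false fun c => !defendSafe false (blackSafe.map encode) c) = true := by
  decide +kernel

theorem mirror_blackSafe_closed :
    ((blackSafe.map fun f => encode (mirror f)).all fun n =>
      !anyMove n true fun c =>
        !defendSafe true (blackSafe.map fun f => encode (mirror f)) c) = true := by
  decide +kernel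

theorem decode_encode_C0 : decode (encode C0) = C0 :=
  decode_encode fun y hy => by
    simp only [board223, Finset.mem_insert, Finset.mem_singleton, not_or] at hy
    simp [C0, mk3, hy]

end Abalone

open Abalone AGame in
/-- 2×2×3 Abalone is weakly solved: the standard initial constellation
`C0` has outcome class `D` — with both players playing optimally neither can force a
win (from either side to move) and the game continues indefinitely. -/
theorem abalone223_draw : G223.OutD C0 := by
  have hb := not_FW_of_closed blackSafe_closed (encode C0)
  have hg := not_FW_of_closed mirror_blackSafe_closed (encode C0)
  rw [decode_encode_C0] at hb hg
  exact ⟨hg.1 (by decide +kernel), hg.2 (by decide +kernel), hb.2 (by decide +kernel),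
    hb.1 (by decide +kernel)⟩
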